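/- arXiv:2507.13535 — 2 statements merged into one kernel-verified Lean document; each statement's English description precedes it below -/
import Mathlib

section
/- (Calderón–Coifman–Meyer type commutator estimate.) Let r > 3/2 and let ρ be a real number with 0 ≤ ρ + 1 ≤ r. There exists a constant C > 0 such that for all Schwartz functions f, v : ℝ → ℂ, ‖Λ^ρ ∂_x (f v) - f · Λ^ρ ∂_x v‖_{L²(ℝ)} ≤ C ‖f‖_{H^r(ℝ)} ‖v‖_{H^ρ(ℝ)}. -/
open MeasureTheory SchwartzMap

/-- The Fourier transform `𝓕f(ξ) = ∫_ℝ e^{-iξx} f(x) dx`. -/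
noncomputable def fourierT (f : ℝ → ℂ) (ξ : ℝ) : ℂ :=
  ∫ x : ℝ, Complex.exp (-(Complex.I * ξ * x)) * f x

/-- The inverse Fourier transform `𝓕⁻¹g(x) = (1/2π) ∫_ℝ e^{iξx} g(ξ) dξ`. -/
noncomputable def invFourierT (g : ℝ → ℂ) (x : ℝ) : ℂ :=
  (1 / (2 * Real.pi)) * ∫ ξ : ℝ, Complex.exp (Complex.I * ξ * x) * g ξ

/-- The Bessel potential operator `Λ^σ f = 𝓕⁻¹((1+ξ²)^{σ/2} 𝓕f)`. -/
noncomputable def bessel (σ : ℝ) (f : ℝ → ℂ) : ℝ → ℂ :=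
  invFourierT fun ξ => (((1 + ξ ^ 2) ^ (σ / 2) : ℝ) : ℂ) * fourierT f ξ

/-- The `L²(ℝ)` norm. -/
noncomputable def L2Norm (f : ℝ → ℂ) : ℝ := Real.sqrt (∫ x : ℝ, ‖f x‖ ^ 2)

/-- The Sobolev norm `‖f‖_{H^σ} = (∫_ℝ (1+ξ²)^σ |𝓕f(ξ)|² dξ)^{1/2}`. -/
noncomputable def HsNorm (σ : ℝ) (f : ℝ → ℂ) : ℝ :=
  Real.sqrt (∫ ξ : ℝ, (1 + ξ ^ 2) ^ σ * ‖fourierT f ξ‖ ^ 2)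

theorem rpow_le_mul_rpow_of_nonneg {a b K e : ℝ} (ha : 0 < a) (hb : 0 < b) (hK : 0 < K)
    (he : 0 ≤ e) (h : a ≤ K * b) : a ^ e ≤ K ^ e * b ^ e := by
  rw [← Real.mul_rpow hK.le hb.le]
  exact Real.rpow_le_rpow ha.le h he

theorem rpow_le_mul_rpow_of_nonpos {a b K e : ℝ} (ha : 0 < a) (hb : 0 < b) (hK : 0 < K)
    (he : e ≤ 0) (h : b ≤ K * a) : a ^ e ≤ K ^ (-e) * b ^ e := by
  have h1 := Real.rpow_le_rpow_of_nonpos hb h he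
  rw [Real.mul_rpow hK.le ha.le] at h1
  calc a ^ e = K ^ (-e) * (K ^ e * a ^ e) := by
        rw [← mul_assoc, ← Real.rpow_add hK]; simp
    _ ≤ _ := by gcongr

theorem rpow_le_mul_rpow_of_comparable {a b K e : ℝ} (ha : 0 < a) (hb : 0 < b) (hK : 0 < K)
    (hab : a ≤ K * b) (hba : b ≤ K * a) : a ^ e ≤ K ^ |e| * b ^ e := by
  rcases le_total 0 e with he | he
  · simpa [abs_of_nonneg he] using rpow_le_mul_rpow_of_nonneg ha hb hK he hab
  · simpa [abs_of_nonpos he] using rpow_le_mul_rpow_of_nonpos ha hb hK he hba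

theorem abs_le_one_add_sq_rpow (x : ℝ) : |x| ≤ (1 + x ^ 2) ^ ((1 : ℝ) / 2) := by
  rw [← Real.sqrt_eq_rpow]
  exact Real.abs_le_sqrt (by linarith)

theorem abs_mul_rpow_le (ρ x : ℝ) :
    |x * (1 + x ^ 2) ^ (ρ / 2)| ≤ (1 + x ^ 2) ^ ((ρ + 1) / 2) := by
  have hx : 0 < 1 + x ^ 2 := by positivity
  rw [abs_mul, abs_of_pos (Real.rpow_pos_of_pos hx _)]
  calc _ ≤ (1 + x ^ 2) ^ ((1 : ℝ) / 2) * (1 + x ^ 2) ^ (ρ / 2) := by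
        gcongr; exact abs_le_one_add_sq_rpow x
    _ = _ := by rw [← Real.rpow_add hx]; ring_nf

theorem hasDerivAt_mul_one_add_sq_rpow (ρ x : ℝ) :
    HasDerivAt (fun x : ℝ => x * (1 + x ^ 2) ^ (ρ / 2))
      ((1 + x ^ 2) ^ (ρ / 2) + ρ * (x ^ 2 * (1 + x ^ 2) ^ (ρ / 2 - 1))) x := by
  have hx : 0 < 1 + x ^ 2 := by positivity
  have h := (hasDerivAt_id x).mul
    ((((hasDerivAt_id x).pow 2).const_add 1).rpow_const (p := ρ / 2) (Or.inl hx.ne'))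
  convert! h using 1
  simp
  ring

theorem abs_deriv_mul_one_add_sq_rpow_le (ρ x : ℝ) :
    |(1 + x ^ 2) ^ (ρ / 2) + ρ * (x ^ 2 * (1 + x ^ 2) ^ (ρ / 2 - 1))| ≤
      (1 + |ρ|) * (1 + x ^ 2) ^ (ρ / 2) := by
  have hx : 0 < 1 + x ^ 2 := by positivity
  have h : x ^ 2 * (1 + x ^ 2) ^ (ρ / 2 - 1) ≤ (1 + x ^ 2) ^ (ρ / 2) :=
    calc _ ≤ (1 + x ^ 2) * (1 + x ^ 2) ^ (ρ / 2 - 1) := by gcongr; linarith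
      _ = _ := by rw [Real.rpow_sub_one hx.ne']; field_simp
  calc _ ≤ |(1 + x ^ 2) ^ (ρ / 2)| + |ρ * (x ^ 2 * (1 + x ^ 2) ^ (ρ / 2 - 1))| := abs_add_le _ _
    _ = (1 + x ^ 2) ^ (ρ / 2) + |ρ| * (x ^ 2 * (1 + x ^ 2) ^ (ρ / 2 - 1)) := by
        rw [abs_mul, abs_of_pos (Real.rpow_pos_of_pos hx _),
          abs_of_nonneg (a := x ^ 2 * _) (by positivity)]
    _ ≤ (1 + x ^ 2) ^ (ρ / 2) + |ρ| * (1 + x ^ 2) ^ (ρ / 2) := by gcongr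
    _ = _ := by ring

theorem abs_symbol_sub_le_of_two_mul_le {ρ ξ η : ℝ} (h : 2 * |ξ - η| ≤ |η|) :
    |ξ * (1 + ξ ^ 2) ^ (ρ / 2) - η * (1 + η ^ 2) ^ (ρ / 2)| ≤
      (1 + |ρ|) * 9 ^ |ρ / 2| * (1 + η ^ 2) ^ (ρ / 2) * |ξ - η| := by
  refine (convex_uIcc η ξ).norm_image_sub_le_of_norm_hasDerivWithin_le
    (f := fun x : ℝ => x * (1 + x ^ 2) ^ (ρ / 2))
    (fun x _ => (hasDerivAt_mul_one_add_sq_rpow ρ x).hasDerivWithinAt) (fun x hx => ?_)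
    Set.left_mem_uIcc Set.right_mem_uIcc
  refine (abs_deriv_mul_one_add_sq_rpow_le ρ x).trans ?_
  rw [mul_assoc]
  have hxη : |x - η| ≤ |ξ - η| := Set.abs_sub_left_of_mem_uIcc hx
  have h1 : |x| ≤ 2 * |η| := by
    linarith [abs_sub_abs_le_abs_sub x η, abs_nonneg η]
  have h2 : |η| ≤ 2 * |x| := by
    linarith [abs_sub_abs_le_abs_sub η x, abs_sub_comm x η]
  gcongr
  apply rpow_le_mul_rpow_of_comparable (by positivity) (by positivity) (by norm_num)
  · have := pow_le_pow_left₀ (abs_nonneg _) h1 2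
    rw [mul_pow, sq_abs, sq_abs] at this
    nlinarith [sq_nonneg η]
  · have := pow_le_pow_left₀ (abs_nonneg _) h2 2
    rw [mul_pow, sq_abs, sq_abs] at this
    nlinarith [sq_nonneg x]

theorem abs_symbol_sub_le_of_le_two_mul {r ρ ξ η : ℝ} (hρ₀ : 0 ≤ ρ + 1) (hρr : ρ + 1 ≤ r)
    (h : |η| ≤ 2 * |ξ - η|) :
    |ξ * (1 + ξ ^ 2) ^ (ρ / 2) - η * (1 + η ^ 2) ^ (ρ / 2)| ≤
      2 * 9 ^ ((ρ + 1) / 2) * 9 ^ (-((ρ + 1 - r) / 2)) *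
        ((1 + (ξ - η) ^ 2) ^ (r / 2) * (1 + η ^ 2) ^ ((ρ + 1 - r) / 2)) := by
  have h1 : |ξ| ≤ 3 * |ξ - η| := by linarith [abs_sub_abs_le_abs_sub ξ η]
  have h1' := pow_le_pow_left₀ (abs_nonneg _) h1 2
  have h' := pow_le_pow_left₀ (abs_nonneg _) h 2
  rw [mul_pow, sq_abs, sq_abs] at h1' h'
  have hζ : 0 < 1 + (ξ - η) ^ 2 := by positivity
  have hξ : 1 + ξ ^ 2 ≤ 9 * (1 + (ξ - η) ^ 2) := by nlinarith
  have hη : 1 + η ^ 2 ≤ 9 * (1 + (ξ - η) ^ 2) := by nlinarith [sq_nonneg (ξ - η)]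
  have e1 := rpow_le_mul_rpow_of_nonneg (e := (ρ + 1) / 2) (by positivity) hζ
    (by norm_num) (by linarith) hξ
  have e2 := rpow_le_mul_rpow_of_nonneg (e := (ρ + 1) / 2) (by positivity) hζ
    (by norm_num) (by linarith) hη
  have e3 := rpow_le_mul_rpow_of_nonpos (e := (ρ + 1 - r) / 2) hζ (by positivity)
    (by norm_num) (by linarith) hη
  calc _ ≤ |ξ * (1 + ξ ^ 2) ^ (ρ / 2)| + |η * (1 + η ^ 2) ^ (ρ / 2)| := abs_sub _ _
    _ ≤ (1 + ξ ^ 2) ^ ((ρ + 1) / 2) + (1 + η ^ 2) ^ ((ρ + 1) / 2) :=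
        add_le_add (abs_mul_rpow_le ρ ξ) (abs_mul_rpow_le ρ η)
    _ ≤ 2 * 9 ^ ((ρ + 1) / 2) * (1 + (ξ - η) ^ 2) ^ ((ρ + 1) / 2) := by linarith
    _ = 2 * 9 ^ ((ρ + 1) / 2) *
          ((1 + (ξ - η) ^ 2) ^ (r / 2) * (1 + (ξ - η) ^ 2) ^ ((ρ + 1 - r) / 2)) := by
        rw [← Real.rpow_add hζ]; ring_nf
    _ ≤ 2 * 9 ^ ((ρ + 1) / 2) * ((1 + (ξ - η) ^ 2) ^ (r / 2) *
          (9 ^ (-((ρ + 1 - r) / 2)) * (1 + η ^ 2) ^ ((ρ + 1 - r) / 2))) := by gcongr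
    _ = _ := by ring

theorem exists_abs_symbol_sub_le {r ρ : ℝ} (hρ₀ : 0 ≤ ρ + 1) (hρr : ρ + 1 ≤ r) :
    ∃ C : ℝ, 0 < C ∧ ∀ ξ η : ℝ,
      |ξ * (1 + ξ ^ 2) ^ (ρ / 2) - η * (1 + η ^ 2) ^ (ρ / 2)| ≤
        C * (((1 + (ξ - η) ^ 2) ^ ((1 - r) / 2) + (1 + η ^ 2) ^ ((1 - r) / 2)) *
          ((1 + (ξ - η) ^ 2) ^ (r / 2) * (1 + η ^ 2) ^ (ρ / 2))) := by
  refine ⟨(1 + |ρ|) * 9 ^ |ρ / 2| + 2 * 9 ^ ((ρ + 1) / 2) * 9 ^ (-((ρ + 1 - r) / 2)),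
    by positivity, fun ξ η => ?_⟩
  have hζ : 0 < 1 + (ξ - η) ^ 2 := by positivity
  have hη : 0 < 1 + η ^ 2 := by positivity
  rw [add_mul ((1 + |ρ|) * _), add_mul ((1 + (ξ - η) ^ 2) ^ ((1 - r) / 2))]
  rcases le_total (2 * |ξ - η|) |η| with h | h
  · refine (abs_symbol_sub_le_of_two_mul_le h).trans ?_
    refine le_add_of_le_of_nonneg ?_ (by positivity)
    rw [mul_assoc _ _ |ξ - η|]
    gcongr
    refine le_add_of_le_of_nonneg ?_ (by positivity)
    rw [← mul_assoc, ← Real.rpow_add hζ, mul_comm]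
    gcongr
    rw [show (1 - r) / 2 + r / 2 = 1 / 2 by ring]
    exact abs_le_one_add_sq_rpow (ξ - η)
  · refine (abs_symbol_sub_le_of_le_two_mul hρ₀ hρr h).trans ?_
    refine le_add_of_nonneg_of_le (by positivity) ?_
    gcongr
    refine le_add_of_nonneg_of_le (by positivity) (le_of_eq ?_)
    rw [mul_left_comm, ← Real.rpow_add hη]
    congr 3
    ring

theorem lintegral_mul_sq_le {α : Type*} [MeasurableSpace α] {μ : Measure α}
    {f g : α → ENNReal} (hf : AEMeasurable f μ) (hg : AEMeasurable g μ) :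
    (∫⁻ x, f x * g x ∂μ) ^ 2 ≤ (∫⁻ x, f x ^ 2 ∂μ) * ∫⁻ x, g x ^ 2 ∂μ := by
  have h := ENNReal.lintegral_mul_le_Lp_mul_Lq μ Real.HolderConjugate.two_two hf hg
  simp only [Pi.mul_apply, ENNReal.rpow_two] at h
  calc _ ≤ _ := pow_le_pow_left' h 2
    _ = _ := by
      rw [mul_pow, ← ENNReal.rpow_mul_natCast, ← ENNReal.rpow_mul_natCast]
      norm_num

theorem lintegral_add_sub_sq_le {w : ℝ → ENNReal} (hw : Measurable w) (s : ℝ) :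
    ∫⁻ t, (w (s - t) + w t) ^ 2 ≤ 4 * ∫⁻ t, w t ^ 2 := by
  calc _ ≤ ∫⁻ t, 2 * (w (s - t) ^ 2 + w t ^ 2) := by
        refine lintegral_mono fun t => ?_
        have := ENNReal.rpow_add_le_mul_rpow_add_rpow (w (s - t)) (w t) (p := 2) (by norm_num)
        norm_num at this
        exact this
    _ = _ := by
        rw [lintegral_const_mul _ (by fun_prop), lintegral_add_right _ (by fun_prop),
          lintegral_sub_left_eq_self (fun t => w t ^ 2)]
        ring

theorem lintegral_sq_lintegral_weighted_convolution_le {w a b : ℝ → ENNReal}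
    (hw : Measurable w) (ha : Measurable a) (hb : Measurable b) :
    ∫⁻ s, (∫⁻ t, (w (s - t) + w t) * (a (s - t) * b t)) ^ 2 ≤
      4 * (∫⁻ t, w t ^ 2) * ((∫⁻ t, a t ^ 2) * ∫⁻ t, b t ^ 2) := by
  calc _ ≤ ∫⁻ s, 4 * (∫⁻ t, w t ^ 2) * ∫⁻ t, (a (s - t) * b t) ^ 2 := by
        refine lintegral_mono fun s => ?_
        refine (lintegral_mul_sq_le (by fun_prop) (by fun_prop)).trans ?_
        gcongr
        exact lintegral_add_sub_sq_le hw s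
    _ = 4 * (∫⁻ t, w t ^ 2) * ∫⁻ s, ∫⁻ t, (a (s - t) * b t) ^ 2 :=
        lintegral_const_mul _ (by fun_prop)
    _ = 4 * (∫⁻ t, w t ^ 2) * ∫⁻ t, ∫⁻ s, (a (s - t) * b t) ^ 2 := by
        rw [lintegral_lintegral_swap (by fun_prop)]
    _ = _ := by
        congr 1
        simp_rw [mul_pow]
        rw [← lintegral_const_mul _ (by fun_prop)]
        refine lintegral_congr fun t => ?_
        rw [lintegral_mul_const _ (by fun_prop), lintegral_sub_right_eq_self (fun s => a s ^ 2)]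

open FourierTransform LineDeriv

theorem fourierT_two_pi_mul (f : ℝ → ℂ) (t : ℝ) : fourierT f (2 * Real.pi * t) = 𝓕 f t := by
  rw [Real.fourier_real_eq_integral_exp_smul, fourierT]
  congr 1 with x
  rw [smul_eq_mul]
  congr 2
  push_cast
  ring

theorem invFourierT_eq_fourierInv (g : ℝ → ℂ) (x : ℝ) :
    invFourierT g x = 𝓕⁻ (fun t => g (2 * Real.pi * t)) x := by
  have h := Measure.integral_comp_mul_left
    (fun ξ : ℝ => Complex.exp (Complex.I * ξ * x) * g ξ) (2 * Real.pi)
  rw [abs_of_pos (by positivity)] at h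
  rw [Real.fourierInv_eq', invFourierT]
  calc _ = ((2 * Real.pi)⁻¹ : ℝ) • ∫ y : ℝ, Complex.exp (Complex.I * y * x) * g y := by
        rw [Complex.real_smul]; push_cast; rw [one_div]
    _ = _ := by
        rw [← h]
        congr 1 with t
        rw [smul_eq_mul]
        congr 2
        simp
        ring

/-- The symbol of `Λ^σ` in the frequency variable `ξ = 2πt`. -/
noncomputable def besselSymbol (σ t : ℝ) : ℝ := (1 + (2 * Real.pi * t) ^ 2) ^ (σ / 2)

theorem besselSymbol_pos (σ t : ℝ) : 0 < besselSymbol σ t := by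
  unfold besselSymbol
  positivity

theorem besselSymbol_hasTemperateGrowth (σ : ℝ) :
    (fun t => (besselSymbol σ t : ℂ)).HasTemperateGrowth := by
  have h : (fun t => besselSymbol σ t).HasTemperateGrowth := by
    have h1 := (Function.hasTemperateGrowth_one_add_norm_sq_rpow ℝ (σ / 2)).comp
      (g := fun x : ℝ => (1 + ‖x‖ ^ 2) ^ (σ / 2)) (f := fun t : ℝ => 2 * Real.pi * t) (by fun_prop)
    simpa [besselSymbol, Function.comp_def] using h1
  exact Function.Complex.hasTemperateGrowth_ofReal.comp h

/-- The Bessel potential as an operator on Schwartz functions. -/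
noncomputable def besselSchwartz (σ : ℝ) : 𝓢(ℝ, ℂ) →L[ℂ] 𝓢(ℝ, ℂ) :=
  fourierMultiplierCLM ℂ fun t => (besselSymbol σ t : ℂ)

theorem fourier_besselSchwartz (σ : ℝ) (f : 𝓢(ℝ, ℂ)) (t : ℝ) :
    𝓕 (besselSchwartz σ f) t = besselSymbol σ t * 𝓕 f t := by
  simp [besselSchwartz, fourierMultiplierCLM_apply, besselSymbol_hasTemperateGrowth]

theorem bessel_coe (σ : ℝ) (f : 𝓢(ℝ, ℂ)) : bessel σ f = besselSchwartz σ f := by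
  ext x
  rw [bessel, invFourierT_eq_fourierInv, besselSchwartz, fourierMultiplierCLM_apply,
    SchwartzMap.fourierInv_coe]
  refine congrArg (fun g : ℝ → ℂ => 𝓕⁻ g x) (funext fun t => ?_)
  rw [SchwartzMap.smulLeftCLM_apply_apply (besselSymbol_hasTemperateGrowth σ), smul_eq_mul,
    fourierT_two_pi_mul, besselSymbol, SchwartzMap.fourier_coe]

theorem deriv_coe (f : 𝓢(ℝ, ℂ)) : deriv f = (∂_{(1 : ℝ)} f : 𝓢(ℝ, ℂ)) := by
  ext x
  rw [SchwartzMap.lineDerivOp_apply_eq_fderiv, fderiv_apply_one_eq_deriv]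

theorem fourier_lineDeriv_one (f : 𝓢(ℝ, ℂ)) (t : ℝ) :
    𝓕 (∂_{(1 : ℝ)} f : 𝓢(ℝ, ℂ)) t = 2 * Real.pi * Complex.I * t * 𝓕 f t := by
  rw [SchwartzMap.fourier_lineDerivOp_eq]
  simp only [RCLike.inner_apply, conj_trivial, one_mul, _root_.smul_apply]
  rw [SchwartzMap.smulLeftCLM_apply_apply (by fun_prop), smul_eq_mul, Complex.real_smul]
  ring

theorem fourier_fourier_neg_apply (f : 𝓢(ℝ, ℂ)) (x : ℝ) : 𝓕 (𝓕 f) (-x) = f x := by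
  have h : 𝓕⁻ (𝓕 f) x = f x := by rw [FourierTransform.fourierInv_fourier_eq]
  rw [← h, SchwartzMap.fourierInv_apply_eq]
  rfl

theorem fourier_pairing_mul (f g : 𝓢(ℝ, ℂ)) (s : ℝ) :
    𝓕 (pairing (ContinuousLinearMap.mul ℂ ℂ) f g) s = ∫ t, 𝓕 f (s - t) * 𝓕 g t := by
  have h : pairing (ContinuousLinearMap.mul ℂ ℂ) f g =
      𝓕⁻ (SchwartzMap.convolution (ContinuousLinearMap.mul ℂ ℂ) (𝓕 f) (𝓕 g)) := by
    ext x
    rw [SchwartzMap.fourierInv_apply_eq, SchwartzMap.fourier_convolution]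
    simp [fourier_fourier_neg_apply]
  rw [h, FourierTransform.fourier_fourierInv_eq, SchwartzMap.convolution_apply,
    MeasureTheory.convolution_mul_swap]

theorem L2Norm_nonneg (f : ℝ → ℂ) : 0 ≤ L2Norm f := Real.sqrt_nonneg _

theorem HsNorm_nonneg (σ : ℝ) (f : ℝ → ℂ) : 0 ≤ HsNorm σ f := Real.sqrt_nonneg _

theorem ofReal_L2Norm_sq (f : 𝓢(ℝ, ℂ)) :
    ENNReal.ofReal (L2Norm f ^ 2) = ∫⁻ t, ‖𝓕 f t‖ₑ ^ 2 := by
  rw [L2Norm, Real.sq_sqrt (by positivity), ← SchwartzMap.integral_norm_sq_fourier]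
  rw [ofReal_integral_eq_lintegral_ofReal]
  · simp [ENNReal.ofReal_pow]
  · have := (𝓕 f).memLp 2
    exact this.integrable_norm_pow (by norm_num)
  · exact ae_of_all _ fun _ => by positivity

theorem HsNorm_sq (σ : ℝ) (f : 𝓢(ℝ, ℂ)) :
    HsNorm σ f ^ 2 = 2 * Real.pi * L2Norm (besselSchwartz σ f) ^ 2 := by
  have h := Measure.integral_comp_mul_left
    (fun ξ : ℝ => (1 + ξ ^ 2) ^ σ * ‖fourierT f ξ‖ ^ 2) (2 * Real.pi)
  rw [abs_of_pos (by positivity), smul_eq_mul, inv_mul_eq_div, eq_div_iff (by positivity)] at h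
  rw [L2Norm, HsNorm, Real.sq_sqrt (by positivity), Real.sq_sqrt (by positivity),
    ← SchwartzMap.integral_norm_sq_fourier, ← h, mul_comm]
  congr 2 with t
  rw [fourierT_two_pi_mul, fourier_besselSchwartz, norm_mul, mul_pow ‖_‖, Complex.norm_real,
    Real.norm_eq_abs, sq_abs, besselSymbol, ← Real.rpow_mul_natCast (by positivity),
    SchwartzMap.fourier_coe]
  simp

theorem fourier_commutator (ρ : ℝ) (f v : 𝓢(ℝ, ℂ)) (s : ℝ) :
    𝓕 (besselSchwartz ρ (∂_{(1 : ℝ)} (pairing (ContinuousLinearMap.mul ℂ ℂ) f v)) -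
        pairing (ContinuousLinearMap.mul ℂ ℂ) f (besselSchwartz ρ (∂_{(1 : ℝ)} v))) s =
      ∫ t, Complex.I * ((2 * Real.pi * s * besselSymbol ρ s -
        2 * Real.pi * t * besselSymbol ρ t : ℝ) : ℂ) * (𝓕 f (s - t) * 𝓕 v t) := by
  have hint (u : 𝓢(ℝ, ℂ)) : Integrable fun t => 𝓕 f (s - t) * 𝓕 u t :=
    (𝓕 u).integrable.bdd_mul (c := SchwartzMap.seminorm ℝ 0 0 (𝓕 f)) (by fun_prop)
      (ae_of_all _ fun t => (𝓕 f).norm_le_seminorm ℝ _)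
  rw [sub_eq_add_neg, FourierTransform.fourier_add, FourierTransform.fourier_neg,
    ← sub_eq_add_neg, _root_.sub_apply, fourier_besselSchwartz,
    fourier_lineDeriv_one, fourier_pairing_mul, fourier_pairing_mul, ← integral_const_mul,
    ← integral_const_mul, ← integral_sub (((hint v).const_mul _).const_mul _) (hint _)]
  congr 1 with t
  rw [fourier_besselSchwartz, fourier_lineDeriv_one]
  push_cast
  ring

theorem L2Norm_besselSchwartz_le (σ : ℝ) (f : 𝓢(ℝ, ℂ)) :
    L2Norm (besselSchwartz σ f) ≤ HsNorm σ f := by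
  refine (sq_le_sq₀ (L2Norm_nonneg _) (HsNorm_nonneg _ _)).1 ?_
  rw [HsNorm_sq]
  exact le_mul_of_one_le_left (sq_nonneg _) (by linarith [Real.pi_gt_three])

theorem integrable_besselSymbol_sq {σ : ℝ} (hσ : σ < -(1 / 2)) :
    Integrable fun t => besselSymbol σ t ^ 2 := by
  have h := (integrable_rpow_neg_one_add_norm_sq (E := ℝ) (μ := volume) (r := -2 * σ)
    (by simp; linarith)).comp_mul_left' (R := 2 * Real.pi) (by positivity)
  refine h.congr (ae_of_all _ fun t => ?_)
  simp only [besselSymbol, Real.norm_eq_abs, sq_abs]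
  rw [← Real.rpow_mul_natCast (by positivity)]
  congr 1
  push_cast
  ring

theorem enorm_fourier_commutator_le {r ρ C : ℝ} (hC : 0 < C)
    (h : ∀ ξ η : ℝ, |ξ * (1 + ξ ^ 2) ^ (ρ / 2) - η * (1 + η ^ 2) ^ (ρ / 2)| ≤
        C * (((1 + (ξ - η) ^ 2) ^ ((1 - r) / 2) + (1 + η ^ 2) ^ ((1 - r) / 2)) *
          ((1 + (ξ - η) ^ 2) ^ (r / 2) * (1 + η ^ 2) ^ (ρ / 2))))
    (f v : 𝓢(ℝ, ℂ)) (s : ℝ) :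
    ‖𝓕 (besselSchwartz ρ (∂_{(1 : ℝ)} (pairing (ContinuousLinearMap.mul ℂ ℂ) f v)) -
        pairing (ContinuousLinearMap.mul ℂ ℂ) f (besselSchwartz ρ (∂_{(1 : ℝ)} v))) s‖ₑ ≤
      ENNReal.ofReal C * ∫⁻ t, (ENNReal.ofReal (besselSymbol (1 - r) (s - t)) +
        ENNReal.ofReal (besselSymbol (1 - r) t)) *
          (‖𝓕 (besselSchwartz r f) (s - t)‖ₑ * ‖𝓕 (besselSchwartz ρ v) t‖ₑ) := by
  rw [fourier_commutator, ← lintegral_const_mul' _ _ ENNReal.ofReal_ne_top]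
  refine (enorm_integral_le_lintegral_enorm _).trans (lintegral_mono fun t => ?_)
  simp only [← ofReal_norm]
  rw [← ENNReal.ofReal_add (besselSymbol_pos _ _).le (besselSymbol_pos _ _).le, ← ENNReal.ofReal_mul (norm_nonneg _),
    ← ENNReal.ofReal_mul (add_pos (besselSymbol_pos _ _) (besselSymbol_pos _ _)).le, ← ENNReal.ofReal_mul hC.le]
  refine ENNReal.ofReal_le_ofReal ?_
  have h' := mul_le_mul_of_nonneg_right (h (2 * Real.pi * s) (2 * Real.pi * t))
    (mul_nonneg (norm_nonneg (𝓕 f (s - t))) (norm_nonneg (𝓕 v t)))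
  rw [← mul_sub] at h'
  simp only [fourier_besselSchwartz, norm_mul, Complex.norm_I, one_mul, Complex.norm_real,
    Real.norm_eq_abs, abs_of_pos (besselSymbol_pos _ _)]
  refine h'.trans (le_of_eq ?_)
  simp only [besselSymbol]
  ring

theorem exists_L2Norm_commutator_le {r ρ : ℝ} (hr : 3 / 2 < r) (hρ₀ : 0 ≤ ρ + 1)
    (hρr : ρ + 1 ≤ r) :
    ∃ C : ℝ, 0 < C ∧ ∀ f v : 𝓢(ℝ, ℂ),
      L2Norm (besselSchwartz ρ (∂_{(1 : ℝ)} (pairing (ContinuousLinearMap.mul ℂ ℂ) f v)) -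
          pairing (ContinuousLinearMap.mul ℂ ℂ) f (besselSchwartz ρ (∂_{(1 : ℝ)} v)) :
            𝓢(ℝ, ℂ)) ≤
        C * L2Norm (besselSchwartz r f) * L2Norm (besselSchwartz ρ v) := by
  obtain ⟨C, hC, hbound⟩ := exists_abs_symbol_sub_le hρ₀ hρr
  set W := ∫ t, besselSymbol (1 - r) t ^ 2 with hW
  have hW0 : 0 ≤ W := integral_nonneg fun _ => sq_nonneg _
  have hmeas : Measurable (besselSymbol (1 - r)) := by unfold besselSymbol; fun_prop
  have hWl : ∫⁻ t, ENNReal.ofReal (besselSymbol (1 - r) t) ^ 2 = ENNReal.ofReal W := by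
    rw [hW, ofReal_integral_eq_lintegral_ofReal (integrable_besselSymbol_sq (by linarith))
      (ae_of_all _ fun _ => sq_nonneg _)]
    simp only [ENNReal.ofReal_pow (besselSymbol_pos _ _).le]
  refine ⟨2 * C * Real.sqrt (W + 1), by positivity, fun f v => ?_⟩
  have hf := L2Norm_nonneg (besselSchwartz r f)
  have hv := L2Norm_nonneg (besselSchwartz ρ v)
  refine (sq_le_sq₀ (L2Norm_nonneg _) (by positivity)).1 ?_
  rw [← ENNReal.ofReal_le_ofReal_iff (by positivity), ofReal_L2Norm_sq]
  calc _ ≤ ∫⁻ s, (ENNReal.ofReal C * ∫⁻ t, (ENNReal.ofReal (besselSymbol (1 - r) (s - t)) +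
        ENNReal.ofReal (besselSymbol (1 - r) t)) *
          (‖𝓕 (besselSchwartz r f) (s - t)‖ₑ * ‖𝓕 (besselSchwartz ρ v) t‖ₑ)) ^ 2 :=
        lintegral_mono fun s => pow_le_pow_left' (enorm_fourier_commutator_le hC hbound f v s) 2
    _ ≤ ENNReal.ofReal C ^ 2 * (4 * ENNReal.ofReal W *
          (ENNReal.ofReal (L2Norm (besselSchwartz r f) ^ 2) *
            ENNReal.ofReal (L2Norm (besselSchwartz ρ v) ^ 2))) := by
        simp_rw [mul_pow]
        rw [lintegral_const_mul' _ _ (by finiteness), ofReal_L2Norm_sq, ofReal_L2Norm_sq, ← hWl]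
        gcongr
        exact lintegral_sq_lintegral_weighted_convolution_le (by fun_prop) (by fun_prop)
          (by fun_prop)
    _ = ENNReal.ofReal (C ^ 2 * (4 * W * (L2Norm (besselSchwartz r f) ^ 2 *
          L2Norm (besselSchwartz ρ v) ^ 2))) := by
        rw [ENNReal.ofReal_mul (by positivity), ENNReal.ofReal_mul (by positivity),
          ENNReal.ofReal_mul (by positivity), ENNReal.ofReal_mul (by positivity),
          ENNReal.ofReal_pow hC.le]
        norm_num
    _ ≤ _ := by
        refine ENNReal.ofReal_le_ofReal ?_
        simp only [mul_pow]
        rw [Real.sq_sqrt (by positivity)]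
        have : C ^ 2 * (4 * W * (L2Norm (besselSchwartz r f) ^ 2 *
            L2Norm (besselSchwartz ρ v) ^ 2)) ≤ C ^ 2 * (4 * (W + 1) *
            (L2Norm (besselSchwartz r f) ^ 2 * L2Norm (besselSchwartz ρ v) ^ 2)) := by
          gcongr
          linarith
        linarith

/-- Calderón–Coifman–Meyer type commutator estimate: for `r > 3/2` and `0 ≤ ρ + 1 ≤ r`,
there is `C > 0` with `‖Λ^ρ ∂ₓ(fv) - f Λ^ρ ∂ₓ v‖_{L²} ≤ C ‖f‖_{H^r} ‖v‖_{H^ρ}`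
for all Schwartz functions `f, v`. -/
theorem ccm_commutator_estimate (r ρ : ℝ) (hr : 3 / 2 < r) (hρ₀ : 0 ≤ ρ + 1)
    (hρr : ρ + 1 ≤ r) :
    ∃ C > (0 : ℝ), ∀ f v : 𝓢(ℝ, ℂ),
      L2Norm (fun x =>
          bessel ρ (deriv fun y => f y * v y) x - f x * bessel ρ (deriv (⇑v)) x) ≤
        C * HsNorm r (⇑f) * HsNorm ρ (⇑v) := by
  obtain ⟨C, hC, h⟩ := exists_L2Norm_commutator_le hr hρ₀ hρr
  refine ⟨C, hC, fun f v => ?_⟩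
  have hfun : (fun x => bessel ρ (deriv fun y => f y * v y) x - f x * bessel ρ (deriv (⇑v)) x) =
      (besselSchwartz ρ (∂_{(1 : ℝ)} (pairing (ContinuousLinearMap.mul ℂ ℂ) f v)) -
        pairing (ContinuousLinearMap.mul ℂ ℂ) f (besselSchwartz ρ (∂_{(1 : ℝ)} v)) :
          𝓢(ℝ, ℂ)) := by
    have hmul : (fun y => f y * v y) = pairing (ContinuousLinearMap.mul ℂ ℂ) f v := rfl
    ext x
    rw [hmul, deriv_coe, deriv_coe, bessel_coe, bessel_coe]
    rfl
  rw [hfun]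
  refine (h f v).trans ?_
  gcongr
  · exact L2Norm_nonneg _
  · exact mul_nonneg hC.le (HsNorm_nonneg _ _)
  · exact L2Norm_besselSchwartz_le r f
  · exact L2Norm_besselSchwartz_le ρ v
end

section
/- (Uniform H^σ bound for the high-frequency approximate solutions.) Let φ be a Schwartz function on ℝ, let δ > 0, σ ≥ 0, and s ∈ ℝ. Then there exists a constant C > 0 such that for every integer n ≥ 1 and every α ∈ ℝ, the function u_h(x) = n^{-δ/2 - s} φ(x/n^δ) cos(nx - α) satisfies ‖u_h‖_{H^σ(ℝ)} ≤ C n^{σ - s}. -/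
open MeasureTheory SchwartzMap

/-- The transform `fourierT` of a Schwartz function is a Schwartz function. -/
lemma exists_schwartzMap_eq_fourierT (φ : 𝓢(ℝ, ℂ)) :
    ∃ Φ : 𝓢(ℝ, ℂ), ∀ ξ, Φ ξ = fourierT φ ξ := by
  have h2π : (2 * Real.pi)⁻¹ ≠ 0 := by positivity
  refine ⟨compCLMOfContinuousLinearEquiv ℝ
    (ContinuousLinearEquiv.unitsEquivAut ℝ (Units.mk0 _ h2π)) (FourierTransform.fourier φ),
    fun ξ => ?_⟩
  simp only [compCLMOfContinuousLinearEquiv_apply, Function.comp_apply,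
    ContinuousLinearEquiv.unitsEquivAut_apply, Units.val_mk0, fourier_coe,
    Real.fourier_real_eq_integral_exp_smul, fourierT, smul_eq_mul]
  congr 1 with x
  congr 2
  push_cast
  have : (Real.pi : ℂ) ≠ 0 := by exact_mod_cast Real.pi_ne_zero
  field_simp

lemma integrable_weight_mul_norm_sq (Φ : 𝓢(ℝ, ℂ)) (σ : ℝ) :
    Integrable fun ξ : ℝ => (1 + ξ ^ 2) ^ σ * ‖Φ ξ‖ ^ 2 := by
  have hg := Function.hasTemperateGrowth_one_add_norm_sq_rpow (H := ℝ) (σ / 2)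
  refine ((smulLeftCLM ℂ (fun x : ℝ => (1 + ‖x‖ ^ 2) ^ (σ / 2)) Φ).memLp 2
    volume).integrable_norm_pow (by norm_num) |>.congr (.of_forall fun ξ => ?_)
  have h1 : 0 ≤ 1 + ξ ^ 2 := by positivity
  beta_reduce
  rw [smulLeftCLM_apply_apply hg, norm_smul, mul_pow]
  simp only [Real.norm_eq_abs, sq_abs]
  rw [← Real.rpow_mul_natCast h1]
  norm_num

lemma fourierT_const_mul (c : ℂ) (f : ℝ → ℂ) (ξ : ℝ) :
    fourierT (fun x => c * f x) ξ = c * fourierT f ξ := by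
  simp only [fourierT, ← integral_const_mul]
  congr 1 with x
  ring

lemma fourierT_comp_div (f : ℝ → ℂ) {N : ℝ} (hN : 0 < N) (ξ : ℝ) :
    fourierT (fun x => f (x / N)) ξ = N * fourierT f (N * ξ) := by
  have h := Measure.integral_comp_div
    (fun y : ℝ => Complex.exp (-(Complex.I * (N * ξ : ℝ) * y)) * f y) N
  rw [abs_of_pos hN, Complex.real_smul] at h
  rw [fourierT, fourierT, ← h]
  congr 1 with x
  have : (N : ℂ) ≠ 0 := by exact_mod_cast hN.ne'
  congr 2
  push_cast
  field_simp

lemma fourierT_mul_cos {f : ℝ → ℂ} (hf : Integrable f) (k α ξ : ℝ) :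
    fourierT (fun x => f x * Real.cos (k * x - α)) ξ =
      (Complex.exp (-(α * Complex.I)) * fourierT f (ξ - k) +
        Complex.exp (α * Complex.I) * fourierT f (ξ + k)) / 2 := by
  have hint (η : ℝ) : Integrable fun x : ℝ => Complex.exp (-(Complex.I * η * x)) * f x := by
    refine hf.bdd_mul (c := 1) (by fun_prop) (.of_forall fun x => ?_)
    simp [Complex.norm_exp]
  simp only [fourierT]
  rw [← integral_const_mul, ← integral_const_mul,
    ← integral_add ((hint _).const_mul _) ((hint _).const_mul _), ← integral_div]
  congr 1 with x
  simp only [← mul_assoc, ← Complex.exp_add]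
  rw [Complex.ofReal_cos, Complex.cos]
  push_cast
  rw [mul_right_comm _ (f x), mul_div_assoc', mul_add, ← Complex.exp_add, ← Complex.exp_add]
  ring_nf

lemma norm_fourierT_mul_cos_sq_le {f : ℝ → ℂ} (hf : Integrable f) (k α ξ : ℝ) :
    ‖fourierT (fun x => f x * Real.cos (k * x - α)) ξ‖ ^ 2 ≤
      (‖fourierT f (ξ - k)‖ ^ 2 + ‖fourierT f (ξ + k)‖ ^ 2) / 2 := by
  rw [fourierT_mul_cos hf, norm_div, Complex.norm_ofNat]
  have h := norm_add_le (Complex.exp (-(α * Complex.I)) * fourierT f (ξ - k))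
    (Complex.exp (α * Complex.I) * fourierT f (ξ + k))
  have h1 : ‖Complex.exp (-(α * Complex.I))‖ = 1 := by simp [Complex.norm_exp]
  rw [norm_mul, norm_mul, h1, Complex.norm_exp_ofReal_mul_I, one_mul, one_mul] at h
  rw [div_pow]
  nlinarith [pow_le_pow_left₀ (norm_nonneg _) h 2,
    sq_nonneg (‖fourierT f (ξ - k)‖ - ‖fourierT f (ξ + k)‖)]

lemma weight_le_mul_weight {σ k N ξ η : ℝ} (hσ : 0 ≤ σ) (hk : 1 ≤ k) (hN : 1 ≤ N)
    (h : ξ ^ 2 ≤ 2 * k ^ 2 + 2 * η ^ 2) :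
    (1 + ξ ^ 2) ^ σ ≤ 3 ^ σ * (k ^ σ) ^ 2 * (1 + (N * η) ^ 2) ^ σ := by
  have hk2 : (k ^ σ) ^ 2 = (k ^ 2) ^ σ := by
    rw [← Real.rpow_natCast, ← Real.rpow_natCast, ← Real.rpow_mul (by positivity),
      ← Real.rpow_mul (by positivity), mul_comm]
  rw [hk2, ← Real.mul_rpow (by positivity) (by positivity),
    ← Real.mul_rpow (by positivity) (by positivity)]
  refine Real.rpow_le_rpow (by positivity) ?_ hσ
  have hk' : 1 ≤ k ^ 2 := one_le_pow₀ hk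
  have hη : η ^ 2 ≤ (N * η) ^ 2 := by
    rw [mul_pow]
    exact le_mul_of_one_le_left (sq_nonneg _) (one_le_pow₀ hN)
  nlinarith [mul_le_mul hk' hη (sq_nonneg _) (by positivity)]

/-- Uniform `H^σ` bound for the high-frequency approximate solutions: for a Schwartz
function `φ`, `δ > 0`, `σ ≥ 0` and `s ∈ ℝ`, there is `C > 0` such that for all integers
`n ≥ 1` and all `α ∈ ℝ`, the function `u_h(x) = n^{-δ/2-s} φ(x/n^δ) cos(nx - α)` satisfies
`‖u_h‖_{H^σ} ≤ C n^{σ-s}`. -/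
theorem high_frequency_uniform_bound (φ : 𝓢(ℝ, ℝ)) (δ σ s : ℝ) (hδ : 0 < δ) (hσ : 0 ≤ σ) :
    ∃ C > (0 : ℝ), ∀ n : ℕ, 1 ≤ n → ∀ α : ℝ,
      HsNorm σ (fun x =>
          (((n : ℝ) ^ (-δ / 2 - s) * φ (x / (n : ℝ) ^ δ) * Real.cos (n * x - α) : ℝ) : ℂ))
        ≤ C * (n : ℝ) ^ (σ - s) := by
  set φc : 𝓢(ℝ, ℂ) := φ.postcompCLM Complex.ofRealCLM with hφc
  obtain ⟨Φ, hΦ⟩ := exists_schwartzMap_eq_fourierT φc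
  set H : ℝ → ℝ := fun ξ => (1 + ξ ^ 2) ^ σ * ‖Φ ξ‖ ^ 2 with hH
  have hHint : Integrable H := integrable_weight_mul_norm_sq Φ σ
  have hI : 0 ≤ ∫ ξ, H ξ := integral_nonneg fun ξ => by positivity
  refine ⟨√(3 ^ σ * (∫ ξ, H ξ) + 1), by positivity, fun n hn α => ?_⟩
  have hn1 : (1 : ℝ) ≤ n := by exact_mod_cast hn
  have hn0 : (0 : ℝ) < n := by positivity
  set N : ℝ := (n : ℝ) ^ δ with hNdef
  have hN : 1 ≤ N := Real.one_le_rpow hn1 hδ.le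
  have hN0 : 0 < N := by positivity
  set c : ℝ := (n : ℝ) ^ (-δ / 2 - s) with hc
  have hcN : ((n : ℝ) ^ σ) ^ 2 * c ^ 2 * N = ((n : ℝ) ^ (σ - s)) ^ 2 := by
    simp only [hc, hNdef, ← Real.rpow_mul_natCast hn0.le, ← Real.rpow_add hn0]
    congr 1
    push_cast
    ring
  have hf : Integrable fun x : ℝ => φc (x / N) := φc.integrable.comp_div hN0.ne'
  have hu : (fun x : ℝ => ((c * φ (x / N) * Real.cos (n * x - α) : ℝ) : ℂ)) =
      fun x => (c : ℂ) * (φc (x / N) * Real.cos (n * x - α)) := by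
    ext x
    simp [hφc, mul_assoc]
  have hpt (ξ : ℝ) : (1 + ξ ^ 2) ^ σ * ‖fourierT
        (fun x => (c : ℂ) * (φc (x / N) * Real.cos (n * x - α))) ξ‖ ^ 2 ≤
      3 ^ σ * ((n : ℝ) ^ (σ - s)) ^ 2 * (N / 2) * (H (N * (ξ - n)) + H (N * (ξ + n))) := by
    have hF := norm_fourierT_mul_cos_sq_le hf n α ξ
    rw [fourierT_comp_div _ hN0, fourierT_comp_div _ hN0, ← hΦ, ← hΦ, norm_mul, norm_mul,
      Complex.norm_real, Real.norm_of_nonneg hN0.le, mul_pow, mul_pow] at hF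
    rw [fourierT_const_mul, norm_mul, mul_pow, Complex.norm_real, Real.norm_eq_abs, sq_abs]
    have h1 := weight_le_mul_weight hσ hn1 hN
      (show ξ ^ 2 ≤ 2 * (n : ℝ) ^ 2 + 2 * (ξ - n) ^ 2 by nlinarith [sq_nonneg (ξ - 2 * n)])
    have h2 := weight_le_mul_weight hσ hn1 hN
      (show ξ ^ 2 ≤ 2 * (n : ℝ) ^ 2 + 2 * (ξ + n) ^ 2 by nlinarith [sq_nonneg (ξ + 2 * n)])
    calc
      _ ≤ (1 + ξ ^ 2) ^ σ * (c ^ 2 * ((N ^ 2 * ‖Φ (N * (ξ - n))‖ ^ 2 +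
          N ^ 2 * ‖Φ (N * (ξ + n))‖ ^ 2) / 2)) := by gcongr
      _ = c ^ 2 * N ^ 2 / 2 * ((1 + ξ ^ 2) ^ σ * ‖Φ (N * (ξ - n))‖ ^ 2 +
          (1 + ξ ^ 2) ^ σ * ‖Φ (N * (ξ + n))‖ ^ 2) := by ring
      _ ≤ c ^ 2 * N ^ 2 / 2 *
          (3 ^ σ * ((n : ℝ) ^ σ) ^ 2 * (1 + (N * (ξ - n)) ^ 2) ^ σ * ‖Φ (N * (ξ - n))‖ ^ 2 +
          3 ^ σ * ((n : ℝ) ^ σ) ^ 2 * (1 + (N * (ξ + n)) ^ 2) ^ σ * ‖Φ (N * (ξ + n))‖ ^ 2) := by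
        gcongr
      _ = _ := by
        rw [← hcN]
        simp only [hH]
        ring
  have hHN : Integrable fun ξ => H (N * ξ) := hHint.comp_mul_left' hN0.ne'
  have hsub : Integrable fun ξ => H (N * (ξ - n)) := hHN.comp_sub_right (n : ℝ)
  have hadd : Integrable fun ξ => H (N * (ξ + n)) := hHN.comp_add_right (n : ℝ)
  have hscale : ∫ ξ, H (N * ξ) = N⁻¹ * ∫ ξ, H ξ := by
    rw [Measure.integral_comp_mul_left, abs_of_pos (by positivity), smul_eq_mul]
  have hmain := integral_mono_of_nonneg (.of_forall fun ξ => by positivity)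
    ((hsub.add hadd).const_mul (3 ^ σ * ((n : ℝ) ^ (σ - s)) ^ 2 * (N / 2)))
    (.of_forall hpt)
  simp only [Pi.add_apply] at hmain
  rw [integral_const_mul, integral_add hsub hadd,
    integral_sub_right_eq_self (fun ξ => H (N * ξ)) (n : ℝ),
    integral_add_right_eq_self (fun ξ => H (N * ξ)) (n : ℝ), hscale] at hmain
  rw [hu, HsNorm]
  refine Real.sqrt_le_iff.mpr ⟨by positivity, hmain.trans ?_⟩
  rw [mul_pow, Real.sq_sqrt (by positivity)]
  calc
    _ = 3 ^ σ * (∫ ξ, H ξ) * ((n : ℝ) ^ (σ - s)) ^ 2 := by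
      field_simp
      ring
    _ ≤ _ := by
      gcongr
      linarith
end
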